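/- Let Γ be a group and let α, β ∈ Γ be distinct. Let 𝔾 be the Γ-labeled graph with six vertices s, v₁, v₂, v₃, v₄, t, with arcs sv₁, sv₂, v₁v₂, v₃v₄, v₃t, v₄t each labeled 1_Γ, and with two parallel arcs from v₁ to v₃ labeled α and β and two parallel arcs from v₂ to v₄ labeled α and β. Then l(𝔾; s, t) = {α, β}. -/

import Mathlib

/-- A Γ-labeled graph: a finite loopless directed multigraph with arcs labeled by
elements of a group Γ.  An arc is represented as a triple `(tail, head, label)`. -/
structure LGraph (V : Type) (Γ : Type) [Group Γ] where
  verts : Set V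
  arcs : Set (V × V × Γ)
  verts_finite : verts.Finite
  arcs_finite : arcs.Finite
  tail_mem : ∀ a ∈ arcs, a.1 ∈ verts
  head_mem : ∀ a ∈ arcs, a.2.1 ∈ verts
  loopless : ∀ a ∈ arcs, a.1 ≠ a.2.1

namespace LGraph

variable {V : Type} {Γ : Type} [Group Γ]

/-- `connects a u v` : the arc `a` joins `u` and `v` (traversed from `u` to `v`,
in either direction of the arc). -/
def connects (a : V × V × Γ) (u v : V) : Prop :=
  (a.1 = u ∧ a.2.1 = v) ∨ (a.1 = v ∧ a.2.1 = u)

/-- Walks in the underlying undirected graph of a Γ-labeled graph. -/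
inductive Walk (G : LGraph V Γ) : V → V → Type
  | nil (v : V) : Walk G v v
  | cons (u v : V) {w : V} (a : V × V × Γ) (ha : a ∈ G.arcs)
      (hstep : connects a u v) (W : Walk G v w) : Walk G u w

variable [DecidableEq V]

/-- `ψ_𝔾(e, v)` : the label contributed by arc `a` when traversed arriving at `v` :
the arc's label if the arc enters `v`, its inverse if it leaves `v`. -/
def stepLabel (v : V) (a : V × V × Γ) : Γ :=
  if a.2.1 = v then a.2.2 else a.2.2⁻¹

namespace Walk

variable {G : LGraph V Γ}

/-- The label `ψ_𝔾(W)` of a walk: the product of the step labels, later steps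
multiplied on the left. -/
def label : {u w : V} → G.Walk u w → Γ
  | _, _, .nil _ => 1
  | _, _, .cons _ v a _ _ W => label W * stepLabel v a

/-- The list of vertices of a walk, in order. -/
def support : {u w : V} → G.Walk u w → List V
  | _, _, .nil v => [v]
  | _, _, .cons u _ _ _ _ W => u :: support W

/-- The list of traversed arcs of a walk, in order. -/
def arcsList : {u w : V} → G.Walk u w → List (V × V × Γ)
  | _, _, .nil _ => []
  | _, _, .cons _ _ a _ _ W => a :: arcsList W

/-- The length (number of edges) of a walk. -/
def length : {u w : V} → G.Walk u w → ℕ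
  | _, _, .nil _ => 0
  | _, _, .cons _ _ _ _ _ W => length W + 1

/-- A walk is a path if all its vertices are distinct. -/
def IsPath {u w : V} (W : G.Walk u w) : Prop := W.support.Nodup

/-- A closed walk is a cycle if it is nonempty, its edges are distinct and its
vertices (except for the repeated end vertex) are distinct. -/
def IsCycle {v : V} (W : G.Walk v v) : Prop :=
  1 ≤ W.length ∧ W.arcsList.Nodup ∧ W.support.dropLast.Nodup

end Walk

/-- `l(𝔾; s, t)` : the set of all labels of s–t paths in `G`. -/
def labelSet (G : LGraph V Γ) (s t : V) : Set Γ :=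
  {γ | ∃ P : G.Walk s t, P.IsPath ∧ P.label = γ}

/-- A Γ-labeled graph is balanced if every cycle has label `1`. -/
def Balanced (G : LGraph V Γ) : Prop :=
  ∀ (v : V) (C : G.Walk v v), C.IsCycle → C.label = 1

/-- Connectivity of (the underlying graph of) a Γ-labeled graph. -/
def Connected (G : LGraph V Γ) : Prop :=
  ∀ u ∈ G.verts, ∀ w ∈ G.verts, Nonempty (G.Walk u w)

/-- `G` has no pair of equivalent arcs: no two distinct arcs that are parallel with
the same label, or antiparallel with mutually inverse labels. -/
def NoEquivArcs (G : LGraph V Γ) : Prop :=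
  ∀ a ∈ G.arcs, ∀ b ∈ G.arcs, a ≠ b →
    ¬ ((a.1 = b.1 ∧ a.2.1 = b.2.1 ∧ a.2.2 = b.2.2) ∨
       (a.1 = b.2.1 ∧ a.2.1 = b.1 ∧ a.2.2 = b.2.2⁻¹))

/-- `(𝔾, s, t) ∈ 𝒟` : `s, t` are distinct vertices, every vertex lies on some
s–t path, and there are no equivalent arcs. -/
def MemD (G : LGraph V Γ) (s t : V) : Prop :=
  s ≠ t ∧ s ∈ G.verts ∧ t ∈ G.verts ∧
  (∀ v ∈ G.verts, ∃ P : G.Walk s t, P.IsPath ∧ v ∈ P.support) ∧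
  G.NoEquivArcs

/-- `(s,t)`-equivalence: `H` is obtained from `G` by shifting by `φ v` at each
vertex `v`, where `φ` vanishes at `s` and `t`. -/
def STEquiv (s t : V) (G H : LGraph V Γ) : Prop :=
  ∃ φ : V → Γ, φ s = 1 ∧ φ t = 1 ∧ H.verts = G.verts ∧
    H.arcs = (fun a : V × V × Γ => (a.1, a.2.1, φ a.2.1 * a.2.2 * (φ a.1)⁻¹)) '' G.arcs

/-- The subgraph induced by a vertex set `X`. -/
def induce (G : LGraph V Γ) (X : Set V) : LGraph V Γ where
  verts := G.verts ∩ X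
  arcs := {a ∈ G.arcs | a.1 ∈ X ∧ a.2.1 ∈ X}
  verts_finite := G.verts_finite.subset Set.inter_subset_left
  arcs_finite := G.arcs_finite.subset fun _ ha => ha.1
  tail_mem := fun a ha => ⟨G.tail_mem a ha.1, ha.2.1⟩
  head_mem := fun a ha => ⟨G.head_mem a ha.1, ha.2.2⟩
  loopless := fun a ha => G.loopless a ha.1

/-- `𝔾 − Y` : deletion of the vertex set `Y`. -/
def delete (G : LGraph V Γ) (Y : Set V) : LGraph V Γ := G.induce Yᶜ

/-- `N_𝔾(X)` : the set of vertices outside `X` adjacent to `X`. -/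
def nbhd (G : LGraph V Γ) (X : Set V) : Set V :=
  {y | y ∉ X ∧ ∃ x ∈ X, ∃ a ∈ G.arcs, connects a x y}

/-- `𝔾⟦X⟧` : the subgraph induced by `X ∪ N(X)` with the edges inside `N(X)` removed. -/
def around (G : LGraph V Γ) (X : Set V) : LGraph V Γ where
  verts := G.verts ∩ (X ∪ G.nbhd X)
  arcs := {a ∈ G.arcs | (a.1 ∈ X ∪ G.nbhd X) ∧ (a.2.1 ∈ X ∪ G.nbhd X) ∧
            ¬ (a.1 ∈ G.nbhd X ∧ a.2.1 ∈ G.nbhd X)}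
  verts_finite := G.verts_finite.subset Set.inter_subset_left
  arcs_finite := G.arcs_finite.subset fun _ ha => ha.1
  tail_mem := fun a ha => ⟨G.tail_mem a ha.1, ha.2.1⟩
  head_mem := fun a ha => ⟨G.head_mem a ha.1, ha.2.2.1⟩
  loopless := fun a ha => G.loopless a ha.1

/-- The arcs of `G` surviving the removal of the vertex set `X`. -/
def keptArcs (G : LGraph V Γ) (X : Set V) : Set (V × V × Γ) :=
  {a ∈ G.arcs | a.1 ∉ X ∧ a.2.1 ∉ X}

/-- `A` contains an arc equivalent to an arc from `x` to `y` with label `γ`. -/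
def hasEquivArc (A : Set (V × V × Γ)) (x y : V) (γ : Γ) : Prop :=
  (x, y, γ) ∈ A ∨ (y, x, γ⁻¹) ∈ A

/-- The new arcs added by a contraction of `X`, between `x` and `y`: an arc from `x`
to `y` with label `γ` for each `γ ∈ l(𝔾⟦X⟧; x, y)`, unless an equivalent arc
already exists among the kept arcs. -/
def newContractionArcs (G : LGraph V Γ) (X : Set V) (x y : V) : Set (V × V × Γ) :=
  {p | ∃ γ ∈ labelSet (G.around X) x y, p = (x, y, γ) ∧ ¬ hasEquivArc (G.keptArcs X) x y γ}

/-- The arc set of the 2-contraction `𝔾 /₂ X`, where `N_𝔾(X) = {x, y}`. -/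
def contract2Arcs (G : LGraph V Γ) (X : Set V) (x y : V) : Set (V × V × Γ) :=
  G.keptArcs X ∪ G.newContractionArcs X x y

/-- The arc set of the 3-contraction `𝔾 /₃ X`, where `N_𝔾(X) = {x, y, z}`. -/
def contract3Arcs (G : LGraph V Γ) (X : Set V) (x y z : V) : Set (V × V × Γ) :=
  G.keptArcs X ∪ G.newContractionArcs X x y ∪ G.newContractionArcs X y z ∪
    G.newContractionArcs X x z

/-- `X` is 2-contractible in `𝔾` (w.r.t. the terminals `s, t`). -/
def TwoContractible (G : LGraph V Γ) (s t : V) (X : Set V) : Prop :=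
  X ⊆ G.verts \ {s, t} ∧
  (∃ x y : V, x ≠ y ∧ G.nbhd X = {x, y}) ∧
  (G.around X).Connected ∧ G.around X ≠ G

/-- `X` is 3-contractible in `𝔾` (w.r.t. the terminals `s, t`). -/
def ThreeContractible (G : LGraph V Γ) (s t : V) (X : Set V) : Prop :=
  X ⊆ G.verts \ {s, t} ∧
  (∃ x y z : V, x ≠ y ∧ x ≠ z ∧ y ≠ z ∧ G.nbhd X = {x, y, z}) ∧
  (G.induce X).Connected ∧ (G.around X).Balanced

/-- The graph obtained by adding a single `s`–`t` edge (with an arbitrary label). -/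
def addEdge (G : LGraph V Γ) (s t : V) (hs : s ∈ G.verts) (ht : t ∈ G.verts)
    (hst : s ≠ t) : LGraph V Γ where
  verts := G.verts
  arcs := insert (s, t, (1 : Γ)) G.arcs
  verts_finite := G.verts_finite
  arcs_finite := G.arcs_finite.insert _
  tail_mem := by
    intro a ha
    rcases Set.mem_insert_iff.mp ha with rfl | h
    · exact hs
    · exact G.tail_mem a h
  head_mem := by
    intro a ha
    rcases Set.mem_insert_iff.mp ha with rfl | h
    · exact ht
    · exact G.head_mem a h
  loopless := by
    intro a ha
    rcases Set.mem_insert_iff.mp ha with rfl | h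
    · exact hst
    · exact G.loopless a h

/-- 2-connectivity: more than 2 vertices, and removing any single vertex leaves
the graph connected. -/
def TwoConnected (G : LGraph V Γ) : Prop :=
  2 < G.verts.ncard ∧ ∀ v : V, (G.delete {v}).Connected

/-- The effect of shifting by `α` at `v` on a single arc. -/
def shiftArc (v : V) (α : Γ) (a : V × V × Γ) : V × V × Γ :=
  (a.1, a.2.1, if a.2.1 = v then α * a.2.2 else if a.1 = v then a.2.2 * α⁻¹ else a.2.2)

/-- The graph obtained from `G` by shifting by `α` at `v`. -/
def shift (G : LGraph V Γ) (v : V) (α : Γ) : LGraph V Γ where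
  verts := G.verts
  arcs := shiftArc v α '' G.arcs
  verts_finite := G.verts_finite
  arcs_finite := G.arcs_finite.image _
  tail_mem := by rintro a ⟨b, hb, rfl⟩; exact G.tail_mem b hb
  head_mem := by rintro a ⟨b, hb, rfl⟩; exact G.head_mem b hb
  loopless := by rintro a ⟨b, hb, rfl⟩; exact G.loopless b hb

/-- The walk in `G.shift v α` corresponding to a walk in `G`. -/
def Walk.shiftMap {G : LGraph V Γ} (v : V) (α : Γ) :
    {u w : V} → G.Walk u w → (G.shift v α).Walk u w
  | _, _, .nil x => .nil x
  | _, _, .cons u x a ha hstep W =>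
      .cons u x (shiftArc v α a) (Set.mem_image_of_mem _ ha) hstep (Walk.shiftMap v α W)

end LGraph
open LGraph in
/-- The Γ-labeled graph of Case (B): vertices `s = 0`, `v₁ = 1`, `v₂ = 2`, `v₃ = 3`,
`v₄ = 4`, `t = 5`; arcs `sv₁, sv₂, v₁v₂, v₃v₄, v₃t, v₄t` labeled `1`, and two
parallel arcs from `vᵢ` to `v_{i+2}` labeled `α` and `β` for `i = 1, 2`. -/
def caseBGraph {Γ : Type} [Group Γ] (α β : Γ) : LGraph (Fin 6) Γ where
  verts := Set.univ
  arcs := {((0 : Fin 6), (1 : Fin 6), (1 : Γ)), (0, 2, 1), (1, 2, 1), (3, 4, 1),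
    (3, 5, 1), (4, 5, 1), (1, 3, α), (1, 3, β), (2, 4, α), (2, 4, β)}
  verts_finite := Set.finite_univ
  arcs_finite := by
    apply Set.Finite.insert; apply Set.Finite.insert; apply Set.Finite.insert
    apply Set.Finite.insert; apply Set.Finite.insert; apply Set.Finite.insert
    apply Set.Finite.insert; apply Set.Finite.insert; apply Set.Finite.insert
    exact Set.finite_singleton _
  tail_mem := fun _ _ => trivial
  head_mem := fun _ _ => trivial
  loopless := by
    intro a ha
    simp only [Set.mem_insert_iff, Set.mem_singleton_iff] at ha
    rcases ha with rfl | rfl | rfl | rfl | rfl | rfl | rfl | rfl | rfl | rfl <;> simp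

namespace LGraph

namespace Walk

variable {V Γ : Type} [Group Γ] {G : LGraph V Γ}

theorem start_mem_support {u w : V} (W : G.Walk u w) : u ∈ W.support := by
  cases W <;> simp [support]

theorem end_mem_support {u w : V} (W : G.Walk u w) : w ∈ W.support := by
  induction W with
  | nil => simp [support]
  | cons u v a ha hstep W ih => simp [support, ih]

/-- A path from a vertex to itself is trivial, so its label is `1`. -/
theorem IsPath.label_eq_one [DecidableEq V] {u w : V} {W : G.Walk u w} (hW : W.IsPath)
    (huw : u = w) : W.label = 1 := by
  cases W with
  | nil => rfl
  | cons _ v a ha hstep W =>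
    subst huw
    exact absurd W.end_mem_support (List.nodup_cons.mp hW).1

end Walk

section CaseB

variable {Γ : Type} [Group Γ] {α β : Γ}

/-- The steps of a walk in the Case (B) graph, with the labels they contribute. -/
theorem caseBGraph_step {u v : Fin 6} {a : Fin 6 × Fin 6 × Γ}
    (ha : a ∈ (caseBGraph α β).arcs) (h : connects a u v) :
    (u = 0 ∧ (v = 1 ∨ v = 2) ∧ stepLabel v a = 1) ∨
    (u = 1 ∧ (v = 0 ∨ v = 2 ∧ stepLabel v a = 1 ∨
      v = 3 ∧ (stepLabel v a = α ∨ stepLabel v a = β))) ∨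
    (u = 2 ∧ (v = 0 ∨ v = 1 ∧ stepLabel v a = 1 ∨
      v = 4 ∧ (stepLabel v a = α ∨ stepLabel v a = β))) ∨
    (u = 3 ∧ (v = 1 ∨ (v = 4 ∨ v = 5) ∧ stepLabel v a = 1)) ∨
    (u = 4 ∧ (v = 2 ∨ (v = 3 ∨ v = 5) ∧ stepLabel v a = 1)) ∨
    u = 5 := by
  simp only [caseBGraph, Set.mem_insert_iff, Set.mem_singleton_iff] at ha
  rcases ha with rfl | rfl | rfl | rfl | rfl | rfl | rfl | rfl | rfl | rfl <;>
    rcases h with ⟨rfl, rfl⟩ | ⟨rfl, rfl⟩ <;> simp [stepLabel]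

/-- A walk from `v₁` (or `v₂`) to `t` meets a neighbour of its start. -/
theorem caseBGraph_neighbour_mem_support {u w : Fin 6} (W : (caseBGraph α β).Walk u w)
    (hw : w = 5) :
    (u = 1 → 0 ∈ W.support ∨ 2 ∈ W.support ∨ 3 ∈ W.support) ∧
    (u = 2 → 0 ∈ W.support ∨ 1 ∈ W.support ∨ 4 ∈ W.support) := by
  cases W with
  | nil => subst hw; simp
  | cons _ v a ha hstep W =>
    have hv := W.start_mem_support
    simp only [Walk.support, List.mem_cons]
    have := caseBGraph_step ha hstep
    grind

/-- A path to `t` from `v₃` or `v₄` that avoids `s` and one of `v₁, v₂` has label `1`. -/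
theorem caseBGraph_label_eq_one {u w : Fin 6} (W : (caseBGraph α β).Walk u w) (hw : w = 5)
    (hW : W.IsPath) (hu : u = 3 ∨ u = 4) (h0 : 0 ∉ W.support)
    (h12 : 1 ∉ W.support ∨ 2 ∉ W.support) : W.label = 1 := by
  induction W with
  | nil => rfl
  | cons u v a ha hstep W ih =>
    have hv := W.start_mem_support
    have hn := caseBGraph_neighbour_mem_support W hw
    obtain ⟨hu', hW'⟩ := List.nodup_cons.mp hW
    have h5 := Walk.IsPath.label_eq_one (W := W) hW'
    have hs := caseBGraph_step ha hstep
    simp only [Walk.support, List.mem_cons, not_or] at h0 h12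
    have ih := ih hw hW'
    simp only [Walk.label]
    have key : (v = 3 ∨ v = 4 ∨ v = 5) ∧ stepLabel v a = 1 := by grind
    rw [key.2, mul_one]
    grind

/-- A path to `t` from `v₁` or `v₂` that avoids `s` has label `α` or `β`. -/
theorem caseBGraph_label_eq_or {u w : Fin 6} (W : (caseBGraph α β).Walk u w) (hw : w = 5)
    (hW : W.IsPath) (hu : u = 1 ∨ u = 2) (h0 : 0 ∉ W.support) :
    W.label = α ∨ W.label = β := by
  induction W with
  | nil => subst hw; simp at hu
  | cons u v a ha hstep W ih =>
    have hv := W.start_mem_support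
    obtain ⟨hu', hW'⟩ := List.nodup_cons.mp hW
    have hs := caseBGraph_step ha hstep
    simp only [Walk.support, List.mem_cons, not_or] at h0
    have ih := ih hw hW'
    have hr := caseBGraph_label_eq_one W hw hW'
    simp only [Walk.label]
    have key : (v = 1 ∨ v = 2) ∧ stepLabel v a = 1 ∨
        (v = 3 ∨ v = 4) ∧ (stepLabel v a = α ∨ stepLabel v a = β) := by grind
    rcases key with ⟨hv', h1⟩ | ⟨hv', h1⟩
    · rw [h1, mul_one]
      exact ih hv' h0.2
    · rw [hr hv' h0.2 (by grind), one_mul]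
      exact h1

/-- The label of a parallel arc from `v₁` to `v₃` is the label of a path from `s` to `t`. -/
theorem mem_labelSet_caseBGraph {γ : Γ} (hγ : (1, 3, γ) ∈ (caseBGraph α β).arcs) :
    γ ∈ labelSet (caseBGraph α β) 0 5 := by
  refine ⟨.cons 0 1 (0, 1, 1) (by simp [caseBGraph]) (.inl ⟨rfl, rfl⟩)
    (.cons 1 3 (1, 3, γ) hγ (.inl ⟨rfl, rfl⟩)
    (.cons 3 5 (3, 5, 1) (by simp [caseBGraph]) (.inl ⟨rfl, rfl⟩) (.nil 5))), ?_, ?_⟩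
  · simp [Walk.IsPath, Walk.support]
  · simp [Walk.label, stepLabel]

end CaseB

end LGraph

open LGraph in
/-- In the Case (B) graph, the set of labels of s–t paths is `{α, β}`. -/
theorem caseBGraph_labelSet {Γ : Type} [Group Γ] (α β : Γ) (hne : α ≠ β) :
    labelSet (caseBGraph α β) (0 : Fin 6) (5 : Fin 6) = {α, β} := by
  apply Set.Subset.antisymm
  · rintro γ ⟨W, hW, rfl⟩
    cases W with
    | cons _ v a ha hstep W =>
      obtain ⟨h0, hW'⟩ := List.nodup_cons.mp hW
      obtain ⟨hv, h1⟩ : (v = 1 ∨ v = 2) ∧ stepLabel v a = 1 := by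
        simpa using caseBGraph_step ha hstep
      simpa [Walk.label, h1] using caseBGraph_label_eq_or W rfl hW' hv h0
  · rintro γ (rfl | rfl) <;> exact mem_labelSet_caseBGraph (by simp [caseBGraph])
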